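/- Let T' : (S × A → ℝ) → (S × A → ℝ) be any operator satisfying, for all Q : S × A → ℝ and all (s,a): (T Q)(s,a) − α (V_Q(s) − Q(s,a)) ≤ (T' Q)(s,a) ≤ (T Q)(s,a), where α ∈ [0,1). Then for every Q_0 : S × A → ℝ, defining Q_{k+1} = T' Q_k and V_k(s) = max_a Q_k(s,a), the sequence V_k(s) converges to V*(s) for every state s. -/

import Mathlib

open Filter Topology Finset

/-- Value function induced by a Q-function: `V_Q(s) = max_a Q(s,a)`. -/
noncomputable def Vof {S A : Type*} [Fintype A] [Nonempty A]
    (Q : S → A → ℝ) (s : S) : ℝ := ⨆ a, Q s a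

/-- Bellman optimality operator `(T Q)(s,a) = r(s,a) + γ Σ_{s'} P(s'|s,a) V_Q(s')`. -/
noncomputable def bellmanOp {S A : Type*} [Fintype S] [Fintype A] [Nonempty A]
    (P : S → A → S → ℝ) (r : S → A → ℝ) (γ : ℝ)
    (Q : S → A → ℝ) : S → A → ℝ :=
  fun s a => r s a + γ * ∑ s', P s a s' * Vof Q s'

/-- Advantage Learning operator `(T_AL Q)(s,a) = (T Q)(s,a) - α (V_Q(s) - Q(s,a))`. -/
noncomputable def alOp {S A : Type*} [Fintype S] [Fintype A] [Nonempty A]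
    (P : S → A → S → ℝ) (r : S → A → ℝ) (γ α : ℝ)
    (Q : S → A → ℝ) : S → A → ℝ :=
  fun s a => bellmanOp P r γ Q s a - α * (Vof Q s - Q s a)

/-- Clipped Advantage Learning operator. -/
noncomputable def clipOp {S A : Type*} [Fintype S] [Fintype A] [Nonempty A]
    (P : S → A → S → ℝ) (r : S → A → ℝ) (γ α c Ql : ℝ)
    (Q : S → A → ℝ) : S → A → ℝ :=
  fun s a => if Q s a - Ql ≥ c * (Vof Q s - Ql)
    then alOp P r γ α Q s a else bellmanOp P r γ Q s a

/-- Sup norm over a finite nonempty domain. -/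
noncomputable def supNorm {S : Type*} [Fintype S] [Nonempty S] (f : S → ℝ) : ℝ :=
  ⨆ s, |f s|

lemma le_Vof {S A : Type*} [Fintype A] [Nonempty A] (Q : S → A → ℝ) (s : S) (a : A) :
    Q s a ≤ Vof Q s := le_ciSup (f := fun a => Q s a) (Set.finite_range _).bddAbove a

lemma exists_Vof {S A : Type*} [Fintype A] [Nonempty A] (Q : S → A → ℝ) (s : S) :
    ∃ a, Q s a = Vof Q s := exists_eq_ciSup_of_finite (f := fun a => Q s a)

lemma avg_ge {S : Type*} [Fintype S] (p : S → ℝ) (h0 : ∀ s, 0 ≤ p s) (h1 : ∑ s, p s = 1)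
    (f g : S → ℝ) (d : ℝ) (h : ∀ s, d ≤ f s - g s) :
    d ≤ ∑ s, p s * f s - ∑ s, p s * g s := by
  have : d = ∑ s, p s * d := by rw [← Finset.sum_mul, h1, one_mul]
  rw [this, ← Finset.sum_sub_distrib]
  refine Finset.sum_le_sum fun s _ => ?_
  rw [← mul_sub]
  exact mul_le_mul_of_nonneg_left (h s) (h0 s)

lemma aux_lim (α : ℝ) (h0 : 0 ≤ α) (h1 : α < 1) (e b v : ℕ → ℝ) (B W : ℝ)
    (hb : Tendsto b atTop (𝓝 B)) (hv : Tendsto v atTop (𝓝 W))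
    (he : ∀ k, b k + α * e k ≤ e (k + 1)) (hev : ∀ k, e k ≤ v k) : B ≤ (1 - α) * W := by
  have h1' : 0 < 1 - α := by linarith
  refine le_of_forall_pos_sub_le fun ε hε => ?_
  obtain ⟨N, hN⟩ := eventually_atTop.1 (hb.eventually (lt_mem_nhds (show B - ε < B by linarith)))
  obtain ⟨x, hx⟩ : ∃ x, (1 - α) * x = B - ε := ⟨(B - ε) / (1 - α), by field_simp⟩
  have key : ∀ k, α ^ k * (e N - x) + x ≤ e (k + N) := by
    intro k
    induction k with
    | zero => simp
    | succ k ih =>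
      have h2 := he (k + N)
      have h3 := hN (k + N) (by omega)
      have h4 := mul_le_mul_of_nonneg_left ih h0
      rw [show k + 1 + N = k + N + 1 by omega, pow_succ]
      nlinarith
  have l1 : Tendsto (fun k : ℕ => α ^ k * (e N - x) + x) atTop (𝓝 (0 * (e N - x) + x)) :=
    ((tendsto_pow_atTop_nhds_zero_of_lt_one h0 h1).mul_const _).add_const _
  have l2 : Tendsto (fun k => v (k + N)) atTop (𝓝 W) := (tendsto_add_atTop_iff_nat N).2 hv
  have := le_of_tendsto_of_tendsto' l1 l2 fun k => (key k).trans (hev _)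
  rw [← hx]
  exact mul_le_mul_of_nonneg_left (by linarith) h1'.le

theorem stmt_5
    {S A : Type*} [Fintype S] [Nonempty S] [Fintype A] [Nonempty A]
    (P : S → A → S → ℝ) (hP0 : ∀ s a s', 0 ≤ P s a s')
    (hP1 : ∀ s a, ∑ s', P s a s' = 1)
    (r : S → A → ℝ) (γ : ℝ) (hγ0 : 0 ≤ γ) (hγ1 : γ < 1)
    (Qstar : S → A → ℝ) (hQstar : bellmanOp P r γ Qstar = Qstar)
    (α : ℝ) (hα0 : 0 ≤ α) (hα1 : α < 1)
    (T' : (S → A → ℝ) → (S → A → ℝ))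
    (hT' : ∀ Q s a,
      bellmanOp P r γ Q s a - α * (Vof Q s - Q s a) ≤ T' Q s a ∧
      T' Q s a ≤ bellmanOp P r γ Q s a)
    (Qseq : ℕ → S → A → ℝ)
    (hQseq : ∀ k, Qseq (k + 1) = T' (Qseq k))
 :
    ∀ s : S, Tendsto (fun k => Vof (Qseq k) s) atTop (𝓝 (Vof Qstar s)) := by
  have up : ∀ k s a, Qseq (k+1) s a ≤ r s a + γ * ∑ s', P s a s' * Vof (Qseq k) s' := by
    intro k s a
    rw [hQseq]; exact (hT' (Qseq k) s a).2
  have lo : ∀ k s a, r s a + γ * ∑ s', P s a s' * Vof (Qseq k) s'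
      - α * (Vof (Qseq k) s - Qseq k s a) ≤ Qseq (k+1) s a := by
    intro k s a
    rw [hQseq]; exact (hT' (Qseq k) s a).1
  have st : ∀ s a, Qstar s a = r s a + γ * ∑ s', P s a s' * Vof Qstar s' := by
    intro s a
    exact (congrFun (congrFun hQstar s) a).symm
  set v : ℕ → S → ℝ := fun k s => Vof (Qseq k) s with hv
  set w : S → ℝ := fun s => Vof Qstar s with hw
  -- a common lower bound
  have bd : ∀ f : S → ℝ, ∃ C, 0 ≤ C ∧ ∀ s, -C ≤ f s := by
    intro f
    refine ⟨∑ s, |f s|, Finset.sum_nonneg fun _ _ => abs_nonneg _, fun s => ?_⟩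
    have := Finset.single_le_sum (f := fun s => |f s|) (fun i _ => abs_nonneg _) (Finset.mem_univ s)
    have := neg_abs_le (f s)
    linarith
  obtain ⟨C, hC0, hC⟩ := bd fun s => v 1 s - v 0 s
  obtain ⟨D, hD0, hD⟩ := bd fun s => w s - v 0 s
  have hupper : ∀ k s, -(D * γ ^ k) ≤ w s - v k s := by
    intro k
    induction k with
    | zero => simpa using hD
    | succ k ih =>
      intro s
      obtain ⟨a, ha⟩ := exists_Vof (Qseq (k+1)) s
      have h1 := up k s a
      have h2 := le_Vof Qstar s a
      rw [st] at h2
      have h3 := mul_le_mul_of_nonneg_left (avg_ge (P s a) (hP0 s a) (hP1 s a) w (v k) _ ih) hγ0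
      rw [ha] at h1
      simp only [hv, hw] at *
      rw [pow_succ]
      linarith
  have hinc : ∀ k s, -(C * γ ^ k) ≤ v (k+1) s - v k s := by
    intro k
    induction k with
    | zero => simpa using hC
    | succ k ih =>
      intro s
      obtain ⟨a, ha⟩ := exists_Vof (Qseq (k+1)) s
      have h1 := up k s a
      have h2 := lo (k+1) s a
      have h4 := le_Vof (Qseq (k+1+1)) s a
      have h3 := mul_le_mul_of_nonneg_left
        (avg_ge (P s a) (hP0 s a) (hP1 s a) (v (k+1)) (v k) _ ih) hγ0
      rw [ha] at h1 h2
      simp only [hv, hw] at *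
      rw [pow_succ]
      linarith
  have hpow := tendsto_pow_atTop_nhds_zero_of_lt_one hγ0 hγ1
  have hconv : ∀ s, ∃ L, Tendsto (fun k => v k s) atTop (𝓝 L) := by
    intro s
    obtain ⟨c, hc⟩ : ∃ c, c * (1 - γ) = C :=
      ⟨C / (1 - γ), div_mul_cancel₀ _ (by linarith)⟩
    have hc0 : 0 ≤ c := by
      by_contra h
      push Not at h
      nlinarith
    have hm : Monotone fun k => v k s - c * γ ^ k := by
      refine monotone_nat_of_le_succ fun k => ?_
      have := hinc k s
      rw [← hc] at this
      rw [pow_succ]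
      linarith
    have hb : BddAbove (Set.range fun k => v k s - c * γ ^ k) := by
      refine ⟨w s + D, ?_⟩
      rintro _ ⟨k, rfl⟩
      have h1 := hupper k s
      have h2 : 0 ≤ c * γ ^ k := by positivity
      have h3 : D * γ ^ k ≤ D := mul_le_of_le_one_right hD0 (pow_le_one₀ hγ0 hγ1.le)
      simp only
      linarith
    have := (tendsto_atTop_ciSup hm hb).add (hpow.const_mul c)
    exact ⟨_, by simpa using this⟩
  choose W hW using hconv
  have hle : ∀ s, W s ≤ w s := by
    intro s
    have h1 : Tendsto (fun k => w s + D * γ ^ k) atTop (𝓝 (w s + D * 0)) :=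
      (hpow.const_mul D).const_add _
    have := le_of_tendsto_of_tendsto' (hW s) h1 fun k => by linarith [hupper k s]
    simpa using this
  have hT : ∀ s a, r s a + γ * ∑ s', P s a s' * W s' ≤ W s := by
    intro s a
    have l : Tendsto (fun k => r s a + γ * ∑ s', P s a s' * v k s' - α * v k s) atTop
        (𝓝 (r s a + γ * ∑ s', P s a s' * W s' - α * W s)) :=
      (((tendsto_finsetSum _ fun s' _ => (hW s').const_mul _).const_mul γ).const_add _).sub
        ((hW s).const_mul α)
    have := aux_lim α hα0 hα1 (fun k => Qseq k s a) _ (fun k => v k s) _ _ l (hW s)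
      (fun k => by have := lo k s a; simp only [hv] at *; linarith)
      (fun k => le_Vof (Qseq k) s a)
    linarith
  obtain ⟨s0, hs0⟩ := Finite.exists_min fun s => W s - w s
  have hd : 0 ≤ W s0 - w s0 := by
    obtain ⟨a, ha⟩ := exists_Vof Qstar s0
    have h1 := st s0 a
    have h2 := hT s0 a
    have h3 := mul_le_mul_of_nonneg_left (avg_ge (P s0 a) (hP0 s0 a) (hP1 s0 a) W w _ hs0) hγ0
    rw [ha] at h1
    simp only [hw] at *
    by_contra h
    push Not at h
    nlinarith
  intro s
  have : W s = w s := le_antisymm (hle s) (by linarith [hs0 s])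
  have h := hW s
  rw [this] at h
  exact h
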